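/- arXiv:2209.05020 — 2 statements merged into one kernel-verified Lean document; each statement's English description precedes it below -/
import Mathlib

section
/- There exists a universal constant C' > 0 such that the following holds. Let N, q, h, T, L, M, U be positive integers, let X ∈ ℝ^{N×q}, and let Ā ∈ ℝ^{N×N} be a real symmetric matrix with eigenvalues λ_1, …, λ_N. Let σ : ℝ → ℝ be 1-Lipschitz with σ(0) = 0 and |σ(t)| ≤ R for all t ∈ ℝ. Fix nonnegative reals B^{(0)}, …, B^{(T+1)}, B^{(A)}, a real γ ≥ 0, and μ ∈ [0,1]. For weight matrices W^{(0)} ∈ ℝ^{q×h}, W^{(1)}, …, W^{(T)} ∈ ℝ^{h×h}, W^{(A)} ∈ ℝ^{N×h}, W^{(T+1)} ∈ ℝ^{h×1} such that every column of W^{(l)} has ℓ1-norm at most B^{(l)} for l = 0, …, T+1 and every column of W^{(A)} has ℓ1-norm at most B^{(A)}, set X_T = σ(σ(⋯σ(X W^{(0)}) W^{(1)} ⋯) W^{(T-1)}) (σ applied entrywise, T layers) and f = (μ (X_T + Σ_{k=1}^{L-1} L γ^k Ā^k X_T (W^{(T)})^k + γ^L Ā^L X_T (W^{(T)})^L) +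 (1−μ) Ā W^{(A)}) W^{(T+1)} ∈ ℝ^N. Let ε be a transductive Rademacher vector with parameter p₀ = MU/(M+U)². Then E_ε[ sup over all admissible weight tuples of |⟨ε, f⟩| ] ≤ C' B^{(T+1)} μ [ 2^T (∏_{l=0}^{T-1} B^{(l)}) √(2MU/(M+U)²) (1 + Σ_{k=1}^{L-1} (B^{(T)})^k L γ^k Σ_{j=1}^N |λ_j|^k + γ^L (B^{(T)})^L Σ_{j=1}^N |λ_j|^L) ‖X‖_F + (Σ_{k=1}^{L-1} (B^{(T)})^k L γ^k Σ_{j=1}^N |λ_j|^k + γ^L (B^{(T)})^L Σ_{j=1}^N |λ_j|^L) √N R ] + (1−μ) 2^{5/2} B^{(T+1)} B^{(A)} (√(MU)/(M+U)) Σ_{i=1}^N |λ_i|. -/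
open Finset

/-- Expectation with respect to a transductive Rademacher vector
`ε ∈ ℝ^N` with i.i.d. coordinates: `P(ε_i = 1) = P(ε_i = -1) = p`,
`P(ε_i = 0) = 1 - 2p`. -/
noncomputable def tExp (N : ℕ) (p : ℝ) (f : (Fin N → ℝ) → ℝ) : ℝ :=
  ∑ s : Fin N → Fin 3,
    (∏ i, (![p, p, 1 - 2 * p] : Fin 3 → ℝ) (s i)) *
      f (fun i => (![(1 : ℝ), -1, 0]) (s i))

/-- Frobenius norm of a real matrix. -/
noncomputable def frob {m n : ℕ} (X : Matrix (Fin m) (Fin n) ℝ) : ℝ :=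
  Real.sqrt (∑ i, ∑ j, (X i j) ^ 2)

/-- `mlp σ X W0 Ws t` is the output of a `(t+1)`-layer MLP with entrywise
activation `σ`: layer `0` is `σ(X W0)`, layer `k+1` multiplies by `Ws k`. -/
noncomputable def mlp {N q h : ℕ} (σ : ℝ → ℝ) (X : Matrix (Fin N) (Fin q) ℝ)
    (W0 : Matrix (Fin q) (Fin h) ℝ) (Ws : ℕ → Matrix (Fin h) (Fin h) ℝ) :
    ℕ → Matrix (Fin N) (Fin h) ℝ
  | 0 => Matrix.of fun i j => σ ((X * W0) i j)
  | (k + 1) => Matrix.of fun i j => σ ((mlp σ X W0 Ws k * Ws k) i j)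

section Expectation

variable {N : ℕ} {p : ℝ}

lemma tExp_succ (N : ℕ) (p : ℝ) (f : (Fin (N + 1) → ℝ) → ℝ) :
    tExp (N + 1) p f = p * tExp N p (fun ε => f (Fin.cons 1 ε))
      + p * tExp N p (fun ε => f (Fin.cons (-1) ε))
      + (1 - 2 * p) * tExp N p (fun ε => f (Fin.cons 0 ε)) := by
  have hcons : ∀ (a : Fin 3) (s : Fin N → Fin 3),
      (fun i => (![(1 : ℝ), -1, 0]) ((Fin.cons a s : Fin (N + 1) → Fin 3) i))
        = (Fin.cons ((![(1 : ℝ), -1, 0]) a) (fun i => (![(1 : ℝ), -1, 0]) (s i)) :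
            Fin (N + 1) → ℝ) := by
    intro a s
    funext i
    refine Fin.cases ?_ (fun j => ?_) i <;> simp
  unfold tExp
  rw [← (Fin.consEquiv (fun _ : Fin (N + 1) => Fin 3)).sum_comp, Fintype.sum_prod_type,
    Fin.sum_univ_three]
  simp only [Fin.consEquiv_apply, hcons, Fin.prod_univ_succ, Fin.cons_zero, Fin.cons_succ,
    mul_assoc, ← Finset.mul_sum]
  simp

lemma tExp_add (f g : (Fin N → ℝ) → ℝ) :
    tExp N p (fun ε => f ε + g ε) = tExp N p f + tExp N p g := by
  simp only [tExp, mul_add, Finset.sum_add_distrib]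

lemma tExp_const_mul (c : ℝ) (f : (Fin N → ℝ) → ℝ) :
    tExp N p (fun ε => c * f ε) = c * tExp N p f := by
  simp only [tExp, Finset.mul_sum]
  exact Finset.sum_congr rfl fun s _ => by ring

lemma tExp_sum {ι : Type*} (s : Finset ι) (f : ι → (Fin N → ℝ) → ℝ) :
    tExp N p (fun ε => ∑ i ∈ s, f i ε) = ∑ i ∈ s, tExp N p (f i) := by
  simp only [tExp, Finset.mul_sum]
  exact Finset.sum_comm

lemma tExp_mono (hp : 0 ≤ p) (hp' : 2 * p ≤ 1) {f g : (Fin N → ℝ) → ℝ}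
    (hfg : ∀ ε, f ε ≤ g ε) : tExp N p f ≤ tExp N p g := by
  refine Finset.sum_le_sum fun s _ => mul_le_mul_of_nonneg_left (hfg _) ?_
  refine Finset.prod_nonneg fun i _ => ?_
  generalize s i = a
  fin_cases a <;> simp <;> linarith

lemma tExp_const (N : ℕ) (p c : ℝ) : tExp N p (fun _ => c) = c := by
  induction N with
  | zero => simp [tExp]
  | succ N ih => rw [tExp_succ, ih]; ring

lemma tExp_comp_neg (f : (Fin N → ℝ) → ℝ) :
    tExp N p (fun ε => f (-ε)) = tExp N p f := by
  induction N with
  | zero => exact congrArg (tExp 0 p) (funext fun ε => congrArg f (Subsingleton.elim _ _))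
  | succ N ih =>
    have hneg : ∀ (a : ℝ) (ε : Fin N → ℝ),
        -(Fin.cons a ε : Fin (N + 1) → ℝ) = Fin.cons (-a) (-ε) := by
      intro a ε
      funext i
      refine Fin.cases ?_ (fun j => ?_) i <;> simp
    rw [tExp_succ, tExp_succ]
    simp only [hneg, neg_neg, neg_zero]
    rw [ih (fun ε => f (Fin.cons (-1) ε)), ih (fun ε => f (Fin.cons 1 ε)),
      ih (fun ε => f (Fin.cons 0 ε))]
    ring

lemma tExp_sq_le (hp : 0 ≤ p) (hp' : 2 * p ≤ 1) (f : (Fin N → ℝ) → ℝ) :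
    tExp N p f ^ 2 ≤ tExp N p (fun ε => f ε ^ 2) := by
  set m := tExp N p f with hm
  have h : tExp N p (fun _ => 0) ≤ tExp N p (fun ε => f ε ^ 2 + (-(2 * m) * f ε + m ^ 2)) :=
    tExp_mono hp hp' fun ε => by nlinarith [sq_nonneg (f ε - m)]
  rw [tExp_const, tExp_add, tExp_add, tExp_const_mul, tExp_const, ← hm] at h
  nlinarith

lemma tExp_add_dotProduct_sq (c : ℝ) (x : Fin N → ℝ) :
    tExp N p (fun ε => (c + ε ⬝ᵥ x) ^ 2) = c ^ 2 + 2 * p * ∑ i, x i ^ 2 := by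
  induction N generalizing c with
  | zero => simp [tExp]
  | succ N ih =>
    have hdot : ∀ (a : ℝ) (ε : Fin N → ℝ),
        c + (Fin.cons a ε : Fin (N + 1) → ℝ) ⬝ᵥ x = (c + a * x 0) + ε ⬝ᵥ (Fin.tail x) := by
      intro a ε
      simp [dotProduct, Fin.sum_univ_succ, Fin.tail, add_assoc]
    rw [tExp_succ]
    simp only [hdot, ih, Fin.sum_univ_succ (fun i => x i ^ 2), Fin.tail]
    ring

lemma tExp_dotProduct_sq (x : Fin N → ℝ) :
    tExp N p (fun ε => (ε ⬝ᵥ x) ^ 2) = 2 * p * ∑ i, x i ^ 2 := by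
  simpa using tExp_add_dotProduct_sq (p := p) 0 x

lemma tExp_abs_dotProduct_le (hp : 0 ≤ p) (hp' : 2 * p ≤ 1) (x : EuclideanSpace ℝ (Fin N)) :
    tExp N p (fun ε => |ε ⬝ᵥ x.ofLp|) ≤ √(2 * p) * ‖x‖ := by
  have h := tExp_sq_le hp hp' (fun ε => |ε ⬝ᵥ x.ofLp|)
  simp only [sq_abs, tExp_dotProduct_sq] at h
  rw [EuclideanSpace.norm_eq, ← Real.sqrt_mul (by positivity)]
  refine Real.le_sqrt_of_sq_le ?_
  simpa using h

end Expectation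

section Contraction

variable {N : ℕ} {p : ℝ}

lemma ciSup_add_ciSup_le_of_lipschitz {ι : Type*} [Nonempty ι] {σ : ℝ → ℝ}
    (hσ : LipschitzWith 1 σ) (b u : ι → ℝ)
    (h1 : BddAbove (Set.range fun i => b i + u i))
    (h2 : BddAbove (Set.range fun i => b i - u i)) :
    (⨆ i, (b i + σ (u i))) + (⨆ i, (b i - σ (u i))) ≤
      (⨆ i, (b i + u i)) + ⨆ i, (b i - u i) := by
  refine ciSup_add_ciSup_le fun i j => ?_
  have hL : |σ (u i) - σ (u j)| ≤ |u i - u j| := by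
    simpa [Real.dist_eq] using hσ.dist_le_mul (u i) (u j)
  have hL' := (le_abs_self _).trans hL
  have a1 := le_ciSup h1 i
  have a2 := le_ciSup h2 j
  have a3 := le_ciSup h1 j
  have a4 := le_ciSup h2 i
  rcases abs_cases (u i - u j) with h | h <;> linarith

lemma abs_dotProduct_le_sum_mul {x : Fin N → ℝ} {K : ℝ} (hx : ∀ n, |x n| ≤ K)
    (ε : Fin N → ℝ) : |ε ⬝ᵥ x| ≤ ∑ n, |ε n| * K := by
  refine (Finset.abs_sum_le_sum_abs _ _).trans (Finset.sum_le_sum fun n _ => ?_)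
  rw [abs_mul]
  exact mul_le_mul_of_nonneg_left (hx n) (abs_nonneg _)

/-- The Ledoux–Talagrand contraction principle for a transductive Rademacher vector. -/
lemma tExp_iSup_comp_le {ι : Type*} [Nonempty ι] (hp : 0 ≤ p) (hp' : 2 * p ≤ 1) {σ : ℝ → ℝ}
    (hσ : LipschitzWith 1 σ) (hσ0 : σ 0 = 0) {K : ℝ} (t : ι → Fin N → ℝ)
    (ht : ∀ i n, |t i n| ≤ K) (a : ι → ℝ) {D : ℝ} (ha : ∀ i, |a i| ≤ D) :
    tExp N p (fun ε => ⨆ i, (a i + ε ⬝ᵥ fun n => σ (t i n))) ≤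
      tExp N p (fun ε => ⨆ i, (a i + ε ⬝ᵥ t i)) := by
  induction N generalizing a D with
  | zero => simp
  | succ N ih =>
    have hdot : ∀ (c : ℝ) (ε : Fin N → ℝ) (x : Fin (N + 1) → ℝ),
        (Fin.cons c ε : Fin (N + 1) → ℝ) ⬝ᵥ x = c * x 0 + ε ⬝ᵥ (fun n => x n.succ) := by
      intro c ε x
      simp [dotProduct, Fin.sum_univ_succ]
    have hσabs : ∀ s, |σ s| ≤ |s| := fun s => by
      simpa [Real.dist_eq, hσ0] using hσ.dist_le_mul s 0
    have hstep : ∀ c : ℝ,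
        tExp N p (fun ε => ⨆ i, (a i + (Fin.cons c ε : Fin (N + 1) → ℝ) ⬝ᵥ
            fun n => σ (t i n))) ≤
          tExp N p (fun ε => ⨆ i, (a i + c * σ (t i 0) + ε ⬝ᵥ fun n => t i n.succ)) := by
      intro c
      simp only [hdot, ← add_assoc]
      refine ih (fun i n => t i n.succ) (fun i n => ht i _) (fun i => a i + c * σ (t i 0))
        (D := D + |c| * K) fun i => ?_
      refine (abs_add_le _ _).trans (add_le_add (ha i) ?_)
      rw [abs_mul]
      exact mul_le_mul_of_nonneg_left ((hσabs _).trans (ht i 0)) (abs_nonneg _)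
    rw [tExp_succ, tExp_succ]
    have hzero := hstep 0
    have hpair : tExp N p (fun ε => ⨆ i, (a i + 1 * σ (t i 0) + ε ⬝ᵥ fun n => t i n.succ))
        + tExp N p (fun ε => ⨆ i, (a i + -1 * σ (t i 0) + ε ⬝ᵥ fun n => t i n.succ))
        ≤ tExp N p (fun ε => ⨆ i, (a i + (Fin.cons 1 ε : Fin (N + 1) → ℝ) ⬝ᵥ t i))
        + tExp N p (fun ε => ⨆ i, (a i + (Fin.cons (-1) ε : Fin (N + 1) → ℝ) ⬝ᵥ t i)) := by
      rw [← tExp_add, ← tExp_add]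
      refine tExp_mono hp hp' fun ε => ?_
      have hb : ∀ c : ℝ, BddAbove (Set.range fun i =>
          (a i + ε ⬝ᵥ fun n => t i n.succ) + c * t i 0) := by
        intro c
        refine ⟨D + ∑ n, |ε n| * K + |c| * K, ?_⟩
        rintro _ ⟨i, rfl⟩
        refine add_le_add (add_le_add ((le_abs_self _).trans (ha i)) ((le_abs_self _).trans
          (abs_dotProduct_le_sum_mul (fun n => ht i n.succ) ε))) ((le_abs_self _).trans ?_)
        rw [abs_mul]
        exact mul_le_mul_of_nonneg_left (ht i 0) (abs_nonneg _)
      have := ciSup_add_ciSup_le_of_lipschitz hσ (fun i => a i + ε ⬝ᵥ fun n => t i n.succ)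
        (fun i => t i 0) (by simpa using hb 1) (by simpa [sub_eq_add_neg] using hb (-1))
      simp only [hdot]
      convert this using 4 <;> ring
    have h1 := hstep 1
    have h2 := hstep (-1)
    have hz : tExp N p (fun ε => ⨆ i, (a i + 0 * σ (t i 0) + ε ⬝ᵥ fun n => t i n.succ))
        = tExp N p (fun ε => ⨆ i, (a i + (Fin.cons 0 ε : Fin (N + 1) → ℝ) ⬝ᵥ t i)) := by
      simp only [hdot, zero_mul, add_zero, zero_add]
    rw [hz] at hzero
    have e1 := mul_le_mul_of_nonneg_left hzero (by linarith : (0 : ℝ) ≤ 1 - 2 * p)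
    have e2 := mul_le_mul_of_nonneg_left (add_le_add h1 h2 |>.trans hpair) hp
    linarith

/-- The supremum of `|⟨ε, x⟩|` over `x ∈ S`. -/
noncomputable def supAbs (S : Set (Fin N → ℝ)) (ε : Fin N → ℝ) : ℝ :=
  ⨆ x : S, |ε ⬝ᵥ (x : Fin N → ℝ)|

lemma bddAbove_range_abs_dotProduct {S : Set (Fin N → ℝ)} {K : ℝ}
    (hS : ∀ x ∈ S, ∀ n, |x n| ≤ K) (ε : Fin N → ℝ) :
    BddAbove (Set.range fun x : S => |ε ⬝ᵥ (x : Fin N → ℝ)|) := by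
  refine ⟨∑ n, |ε n| * K, ?_⟩
  rintro _ ⟨x, rfl⟩
  exact abs_dotProduct_le_sum_mul (hS x x.2) ε

lemma abs_dotProduct_le_supAbs {S : Set (Fin N → ℝ)} {K : ℝ}
    (hS : ∀ x ∈ S, ∀ n, |x n| ≤ K) (ε : Fin N → ℝ) {x : Fin N → ℝ} (hx : x ∈ S) :
    |ε ⬝ᵥ x| ≤ supAbs S ε :=
  le_ciSup (bddAbove_range_abs_dotProduct hS ε) ⟨x, hx⟩

lemma supAbs_nonneg (S : Set (Fin N → ℝ)) (ε : Fin N → ℝ) : 0 ≤ supAbs S ε :=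
  Real.iSup_nonneg fun _ => abs_nonneg _

lemma tExp_supAbs_image_comp_le (hp : 0 ≤ p) (hp' : 2 * p ≤ 1) {σ : ℝ → ℝ}
    (hσ : LipschitzWith 1 σ) (hσ0 : σ 0 = 0) {S : Set (Fin N → ℝ)} {K : ℝ}
    (hS : ∀ x ∈ S, ∀ n, |x n| ≤ K) (h0 : (0 : Fin N → ℝ) ∈ S) :
    tExp N p (supAbs ((fun x => σ ∘ x) '' S)) ≤ 2 * tExp N p (supAbs S) := by
  have hσabs : ∀ s, |σ s| ≤ |s| := fun s => by
    simpa [Real.dist_eq, hσ0] using hσ.dist_le_mul s 0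
  have hne : Nonempty S := ⟨⟨0, h0⟩⟩
  let g : (Fin N → ℝ) → ℝ := fun ε => ⨆ x : S, (0 + ε ⬝ᵥ fun n => σ ((x : Fin N → ℝ) n))
  have hbdd : ∀ ε : Fin N → ℝ,
      BddAbove (Set.range fun x : S => (0 + ε ⬝ᵥ fun n => σ ((x : Fin N → ℝ) n))) := by
    refine fun ε => ⟨∑ n, |ε n| * K, ?_⟩
    rintro _ ⟨x, rfl⟩
    simp only [zero_add]
    exact (le_abs_self _).trans
      (abs_dotProduct_le_sum_mul (fun n => (hσabs _).trans (hS x x.2 n)) ε)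
  have hg0 : ∀ ε, 0 ≤ g ε := fun ε => by
    refine le_trans (le_of_eq ?_) (le_ciSup (hbdd ε) ⟨0, h0⟩)
    simp [hσ0, dotProduct]
  have hle : ∀ ε, supAbs ((fun x => σ ∘ x) '' S) ε ≤ g ε + g (-ε) := by
    intro ε
    refine Real.iSup_le ?_ (add_nonneg (hg0 _) (hg0 _))
    rintro ⟨_, x, hx, rfl⟩
    have h1 : ε ⬝ᵥ (σ ∘ x) ≤ g ε := by
      refine le_trans (le_of_eq ?_) (le_ciSup (hbdd ε) ⟨x, hx⟩)
      simp [Function.comp_def]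
    have h2 : -(ε ⬝ᵥ (σ ∘ x)) ≤ g (-ε) := by
      refine le_trans (le_of_eq ?_) (le_ciSup (hbdd (-ε)) ⟨x, hx⟩)
      simp [Function.comp_def]
    exact abs_le.2 ⟨by linarith [hg0 ε], by linarith [hg0 (-ε)]⟩
  calc tExp N p (supAbs ((fun x => σ ∘ x) '' S))
      ≤ tExp N p (fun ε => g ε + g (-ε)) := tExp_mono hp hp' hle
    _ = 2 * tExp N p g := by rw [tExp_add, tExp_comp_neg]; ring
    _ ≤ 2 * tExp N p (supAbs S) := by
        refine mul_le_mul_of_nonneg_left ?_ zero_le_two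
        refine (tExp_iSup_comp_le hp hp' hσ hσ0 (fun (x : S) => (x : Fin N → ℝ))
          (fun x n => hS x x.2 n) (fun _ => 0) (D := 0) (by simp)).trans ?_
        refine tExp_mono hp hp' fun ε => ciSup_mono (bddAbove_range_abs_dotProduct hS ε) ?_
        intro x
        simpa using le_abs_self _

end Contraction

section NetworkClass

variable {N : ℕ} {p : ℝ}

/-- All finite combinations of elements of `S` with coefficients of `ℓ¹`-norm at most `b`. -/
def l1Hull (b : ℝ) (S : Set (Fin N → ℝ)) : Set (Fin N → ℝ) :=
  {x | ∃ (m : ℕ) (f : Fin m → Fin N → ℝ) (c : Fin m → ℝ),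
    (∀ r, f r ∈ S) ∧ ∑ r, |c r| ≤ b ∧ x = ∑ r, c r • f r}

lemma zero_mem_l1Hull {b : ℝ} (hb : 0 ≤ b) (S : Set (Fin N → ℝ)) : 0 ∈ l1Hull b S :=
  ⟨0, Fin.elim0, Fin.elim0, fun r => r.elim0, by simpa using hb, by simp⟩

lemma norm_map_le_of_mem_l1Hull {E : Type*} [NormedAddCommGroup E] [NormedSpace ℝ E]
    (φ : (Fin N → ℝ) →ₗ[ℝ] E) {b K : ℝ} (hK : 0 ≤ K) {S : Set (Fin N → ℝ)}
    (hS : ∀ x ∈ S, ‖φ x‖ ≤ K) {x : Fin N → ℝ} (hx : x ∈ l1Hull b S) : ‖φ x‖ ≤ b * K := by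
  obtain ⟨m, f, c, hf, hc, rfl⟩ := hx
  calc ‖φ (∑ r, c r • f r)‖ = ‖∑ r, c r • φ (f r)‖ := by simp
    _ ≤ ∑ r, |c r| * K := norm_sum_le_of_le _ fun r _ => by
        rw [norm_smul, Real.norm_eq_abs]
        exact mul_le_mul_of_nonneg_left (hS _ (hf r)) (abs_nonneg _)
    _ ≤ b * K := by
        rw [← Finset.sum_mul]
        exact mul_le_mul_of_nonneg_right hc hK

lemma norm_toLp_le_of_mem_l1Hull {b K : ℝ} (hK : 0 ≤ K) {S : Set (Fin N → ℝ)}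
    (hS : ∀ x ∈ S, ‖WithLp.toLp 2 x‖ ≤ K) {x : Fin N → ℝ} (hx : x ∈ l1Hull b S) :
    ‖WithLp.toLp 2 x‖ ≤ b * K :=
  norm_map_le_of_mem_l1Hull (WithLp.linearEquiv 2 ℝ (Fin N → ℝ)).symm.toLinearMap hK hS hx

lemma abs_dotProduct_le_of_mem_l1Hull {b K : ℝ} {S : Set (Fin N → ℝ)}
    (hS : ∀ x ∈ S, ∀ n, |x n| ≤ K) (ε : Fin N → ℝ) {x : Fin N → ℝ} (hx : x ∈ l1Hull b S) :
    |ε ⬝ᵥ x| ≤ b * supAbs S ε := by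
  have h := norm_map_le_of_mem_l1Hull (∑ n, ε n • LinearMap.proj n) (supAbs_nonneg S ε) (S := S)
    (fun y hy => by simpa [dotProduct] using abs_dotProduct_le_supAbs hS ε hy) hx
  simpa [dotProduct] using h

lemma abs_le_norm_toLp (x : Fin N → ℝ) (n : Fin N) : |x n| ≤ ‖WithLp.toLp 2 x‖ := by
  simpa using PiLp.norm_apply_le (p := 2) (WithLp.toLp 2 x) n

lemma norm_toLp_comp_le {σ : ℝ → ℝ} (hσ : ∀ s, |σ s| ≤ |s|) (x : Fin N → ℝ) :
    ‖WithLp.toLp 2 (σ ∘ x)‖ ≤ ‖WithLp.toLp 2 x‖ := by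
  rw [EuclideanSpace.norm_eq, EuclideanSpace.norm_eq]
  refine Real.sqrt_le_sqrt (Finset.sum_le_sum fun n _ => ?_)
  exact pow_le_pow_left₀ (norm_nonneg _) (hσ _) 2

lemma frob_nonneg {m n : ℕ} (X : Matrix (Fin m) (Fin n) ℝ) : 0 ≤ frob X := Real.sqrt_nonneg _

lemma norm_toLp_col_le_frob {q : ℕ} (X : Matrix (Fin N) (Fin q) ℝ) (j : Fin q) :
    ‖WithLp.toLp 2 (X.col j)‖ ≤ frob X := by
  rw [EuclideanSpace.norm_eq, frob]
  refine Real.sqrt_le_sqrt (Finset.sum_le_sum fun n _ => ?_)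
  simpa using Finset.single_le_sum (f := fun j => X n j ^ 2) (fun _ _ => sq_nonneg _)
    (Finset.mem_univ j)

lemma tExp_supAbs_range_col_le (hp : 0 ≤ p) (hp' : 2 * p ≤ 1) {q : ℕ}
    (X : Matrix (Fin N) (Fin q) ℝ) :
    tExp N p (supAbs (Set.range X.col)) ≤ √(2 * p) * frob X := by
  have hsq : ∀ ε, supAbs (Set.range X.col) ε ^ 2 ≤ ∑ j, (ε ⬝ᵥ X.col j) ^ 2 := by
    intro ε
    have h : supAbs (Set.range X.col) ε ≤ √(∑ j, (ε ⬝ᵥ X.col j) ^ 2) := by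
      refine Real.iSup_le ?_ (Real.sqrt_nonneg _)
      rintro ⟨_, j, rfl⟩
      refine Real.le_sqrt_of_sq_le ?_
      rw [sq_abs]
      exact Finset.single_le_sum (f := fun j => (ε ⬝ᵥ X.col j) ^ 2) (fun _ _ => sq_nonneg _)
        (Finset.mem_univ j)
    exact (Real.le_sqrt (supAbs_nonneg _ _) (Finset.sum_nonneg fun _ _ => sq_nonneg _)).1 h
  rw [frob, ← Real.sqrt_mul (by positivity)]
  refine Real.le_sqrt_of_sq_le ((tExp_sq_le hp hp' _).trans ((tExp_mono hp hp' hsq).trans ?_))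
  rw [tExp_sum]
  simp only [tExp_dotProduct_sq, Matrix.col_apply]
  rw [← Finset.mul_sum, Finset.sum_comm]

/-- The possible columns of the output of a `(k+1)`-layer MLP on input `X`, with weights whose
columns have `ℓ¹`-norms bounded by `B`. -/
def netClass {q : ℕ} (σ : ℝ → ℝ) (X : Matrix (Fin N) (Fin q) ℝ) (B : ℕ → ℝ) :
    ℕ → Set (Fin N → ℝ)
  | 0 => (fun x => σ ∘ x) '' l1Hull (B 0) (Set.range X.col)
  | (k + 1) => (fun x => σ ∘ x) '' l1Hull (B (k + 1)) (netClass σ X B k)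

lemma norm_toLp_le_of_mem_netClass {q : ℕ} {σ : ℝ → ℝ} (hσ : ∀ s, |σ s| ≤ |s|)
    (X : Matrix (Fin N) (Fin q) ℝ) {B : ℕ → ℝ} {k : ℕ} (hB : ∀ l ≤ k, 0 ≤ B l) :
    ∀ x ∈ netClass σ X B k, ‖WithLp.toLp 2 x‖ ≤ (∏ l ∈ Finset.range (k + 1), B l) * frob X := by
  induction k with
  | zero =>
    rintro _ ⟨x, hx, rfl⟩
    refine (norm_toLp_comp_le hσ x).trans ?_
    simpa using norm_toLp_le_of_mem_l1Hull (frob_nonneg X)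
      (by rintro _ ⟨j, rfl⟩; exact norm_toLp_col_le_frob X j) hx
  | succ k ih =>
    rintro _ ⟨x, hx, rfl⟩
    refine (norm_toLp_comp_le hσ x).trans ?_
    have hK : 0 ≤ (∏ l ∈ Finset.range (k + 1), B l) * frob X :=
      mul_nonneg (Finset.prod_nonneg fun l hl => hB l (Finset.mem_range.1 hl).le) (frob_nonneg X)
    refine (norm_toLp_le_of_mem_l1Hull hK (ih fun l hl => hB l (hl.trans k.le_succ)) hx).trans
      (le_of_eq ?_)
    rw [Finset.prod_range_succ _ (k + 1)]
    ring

lemma tExp_supAbs_layer_le (hp : 0 ≤ p) (hp' : 2 * p ≤ 1) {σ : ℝ → ℝ}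
    (hσ : LipschitzWith 1 σ) (hσ0 : σ 0 = 0) {b : ℝ} (hb : 0 ≤ b) {S : Set (Fin N → ℝ)} {K : ℝ}
    (hK : 0 ≤ K) (hS : ∀ x ∈ S, ‖WithLp.toLp 2 x‖ ≤ K) :
    tExp N p (supAbs ((fun x => σ ∘ x) '' l1Hull b S)) ≤ 2 * b * tExp N p (supAbs S) := by
  refine (tExp_supAbs_image_comp_le hp hp' hσ hσ0 (K := b * K) (fun x hx n =>
    (abs_le_norm_toLp x n).trans (norm_toLp_le_of_mem_l1Hull hK hS hx))
    (zero_mem_l1Hull hb S)).trans ?_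
  rw [mul_assoc, ← tExp_const_mul b]
  refine mul_le_mul_of_nonneg_left (tExp_mono hp hp' fun ε => ?_) zero_le_two
  refine Real.iSup_le ?_ (mul_nonneg hb (supAbs_nonneg _ _))
  rintro ⟨x, hx⟩
  exact abs_dotProduct_le_of_mem_l1Hull
    (fun y hy n => (abs_le_norm_toLp y n).trans (hS y hy)) ε hx

lemma tExp_supAbs_netClass_le (hp : 0 ≤ p) (hp' : 2 * p ≤ 1) {q : ℕ} {σ : ℝ → ℝ}
    (hσ : LipschitzWith 1 σ) (hσ0 : σ 0 = 0) (X : Matrix (Fin N) (Fin q) ℝ) {B : ℕ → ℝ} {k : ℕ}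
    (hB : ∀ l ≤ k, 0 ≤ B l) :
    tExp N p (supAbs (netClass σ X B k)) ≤
      2 ^ (k + 1) * (∏ l ∈ Finset.range (k + 1), B l) * √(2 * p) * frob X := by
  have hσabs : ∀ s, |σ s| ≤ |s| := fun s => by
    simpa [Real.dist_eq, hσ0] using hσ.dist_le_mul s 0
  induction k with
  | zero =>
    have hb := hB 0 le_rfl
    refine (tExp_supAbs_layer_le hp hp' hσ hσ0 hb (frob_nonneg X)
      (by rintro _ ⟨j, rfl⟩; exact norm_toLp_col_le_frob X j)).trans ?_
    refine (mul_le_mul_of_nonneg_left (tExp_supAbs_range_col_le hp hp' X)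
      (by positivity)).trans (le_of_eq ?_)
    simp
    ring
  | succ k ih =>
    have hb := hB (k + 1) le_rfl
    have hB' : ∀ l ≤ k, 0 ≤ B l := fun l hl => hB l (hl.trans k.le_succ)
    have hK : 0 ≤ (∏ l ∈ Finset.range (k + 1), B l) * frob X :=
      mul_nonneg (Finset.prod_nonneg fun l hl => hB l (Finset.mem_range.1 hl).le) (frob_nonneg X)
    refine (tExp_supAbs_layer_le hp hp' hσ hσ0 hb hK
      (norm_toLp_le_of_mem_netClass hσabs X hB')).trans ?_
    refine (mul_le_mul_of_nonneg_left (ih hB') (by positivity)).trans (le_of_eq ?_)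
    rw [Finset.prod_range_succ _ (k + 1), pow_succ 2 (k + 1)]
    ring

lemma mulVec_mem_l1Hull {h : ℕ} {Y : Matrix (Fin N) (Fin h) ℝ} {S : Set (Fin N → ℝ)}
    (hY : ∀ r, Y.col r ∈ S) {b : ℝ} {c : Fin h → ℝ} (hc : ∑ r, |c r| ≤ b) :
    Y.mulVec c ∈ l1Hull b S := by
  refine ⟨h, Y.col, c, hY, hc, ?_⟩
  funext n
  simp [Matrix.mulVec, dotProduct, mul_comm]

lemma col_mlp_mem_netClass {q h : ℕ} (σ : ℝ → ℝ) (X : Matrix (Fin N) (Fin q) ℝ)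
    {W0 : Matrix (Fin q) (Fin h) ℝ} {Ws : ℕ → Matrix (Fin h) (Fin h) ℝ} {B : ℕ → ℝ}
    (h0 : ∀ c, ∑ r, |W0 r c| ≤ B 0) {k : ℕ}
    (hW : ∀ l, l < k → ∀ c, ∑ r, |Ws l r c| ≤ B (l + 1)) (c : Fin h) :
    (mlp σ X W0 Ws k).col c ∈ netClass σ X B k := by
  induction k generalizing c with
  | zero =>
    exact ⟨X.mulVec (W0.col c), mulVec_mem_l1Hull (fun r => Set.mem_range_self r) (h0 c), rfl⟩
  | succ k ih =>
    exact ⟨(mlp σ X W0 Ws k).mulVec ((Ws k).col c),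
      mulVec_mem_l1Hull (ih fun l hl => hW l (hl.trans k.lt_succ_self)) (hW k k.lt_succ_self c),
      rfl⟩

end NetworkClass

section LinearAlgebra

lemma sum_abs_mulVec_le {m n : ℕ} {W : Matrix (Fin m) (Fin n) ℝ} {b d : ℝ} (hb : 0 ≤ b)
    (hW : ∀ c, ∑ r, |W r c| ≤ b) {w : Fin n → ℝ} (hw : ∑ c, |w c| ≤ d) :
    ∑ r, |W.mulVec w r| ≤ b * d := by
  calc ∑ r, |W.mulVec w r| ≤ ∑ r, ∑ c, |W r c| * |w c| :=
        Finset.sum_le_sum fun r _ => by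
          simpa only [abs_mul, Matrix.mulVec, dotProduct] using
            Finset.abs_sum_le_sum_abs (fun c => W r c * w c) Finset.univ
    _ = ∑ c, (∑ r, |W r c|) * |w c| := by
        rw [Finset.sum_comm]
        simp only [Finset.sum_mul]
    _ ≤ ∑ c, b * |w c| :=
        Finset.sum_le_sum fun c _ => mul_le_mul_of_nonneg_right (hW c) (abs_nonneg _)
    _ ≤ b * d := by
        rw [← Finset.mul_sum]
        exact mul_le_mul_of_nonneg_left hw hb

lemma sum_abs_pow_mulVec_le {n : ℕ} {W : Matrix (Fin n) (Fin n) ℝ} {b d : ℝ} (hb : 0 ≤ b)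
    (hW : ∀ c, ∑ r, |W r c| ≤ b) {w : Fin n → ℝ} (hw : ∑ c, |w c| ≤ d) (k : ℕ) :
    ∑ r, |(W ^ k).mulVec w r| ≤ b ^ k * d := by
  induction k with
  | zero => simpa using hw
  | succ k ih =>
    rw [pow_succ', ← Matrix.mulVec_mulVec, pow_succ', mul_assoc]
    exact sum_abs_mulVec_le hb hW ih

lemma norm_toLp_le_sum_abs {N : ℕ} (x : Fin N → ℝ) : ‖WithLp.toLp 2 x‖ ≤ ∑ n, |x n| := by
  rw [EuclideanSpace.norm_eq]
  refine Real.sqrt_le_iff.2 ⟨Finset.sum_nonneg fun _ _ => abs_nonneg _, ?_⟩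
  simpa using Finset.sum_sq_le_sq_sum_of_nonneg (s := Finset.univ) (f := fun n => |x n|)
    fun _ _ => abs_nonneg _

lemma pow_mulVec_eigenvectorBasis {N : ℕ} {A : Matrix (Fin N) (Fin N) ℝ} (hA : A.IsHermitian)
    (k : ℕ) (j : Fin N) :
    (A ^ k).mulVec (hA.eigenvectorBasis j).ofLp
      = hA.eigenvalues j ^ k • (hA.eigenvectorBasis j).ofLp := by
  induction k with
  | zero => simp
  | succ k ih =>
    rw [pow_succ, ← Matrix.mulVec_mulVec, hA.mulVec_eigenvectorBasis, Matrix.mulVec_smul, ih,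
      smul_smul, pow_succ']

lemma abs_dotProduct_pow_mulVec_le {N : ℕ} {A : Matrix (Fin N) (Fin N) ℝ} (hA : A.IsHermitian)
    (k : ℕ) (ε x : Fin N → ℝ) :
    |ε ⬝ᵥ (A ^ k).mulVec x| ≤
      (∑ j, |hA.eigenvalues j| ^ k * |ε ⬝ᵥ (hA.eigenvectorBasis j).ofLp|)
        * ‖WithLp.toLp 2 x‖ := by
  have hsymm : (A ^ k).transpose = A ^ k := by
    have := (hA.pow k).eq
    rwa [Matrix.conjTranspose_eq_transpose_of_trivial] at this
  have hdual : ∀ j, (hA.eigenvectorBasis j).ofLp ⬝ᵥ (A ^ k).mulVec x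
      = hA.eigenvalues j ^ k * ((hA.eigenvectorBasis j).ofLp ⬝ᵥ x) := by
    intro j
    rw [Matrix.dotProduct_mulVec, ← Matrix.mulVec_transpose, hsymm, pow_mulVec_eigenvectorBasis,
      smul_dotProduct, smul_eq_mul]
  have hexp : ε ⬝ᵥ (A ^ k).mulVec x = ∑ j, (ε ⬝ᵥ (hA.eigenvectorBasis j).ofLp) *
      ((hA.eigenvectorBasis j).ofLp ⬝ᵥ (A ^ k).mulVec x) := by
    have := hA.eigenvectorBasis.sum_inner_mul_inner (WithLp.toLp 2 ε)
      (WithLp.toLp 2 ((A ^ k).mulVec x))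
    simp only [EuclideanSpace.inner_eq_star_dotProduct, star_trivial] at this
    rw [dotProduct_comm, ← this]
    exact Finset.sum_congr rfl fun j _ => by
      rw [dotProduct_comm ε, dotProduct_comm _ ((A ^ k).mulVec x)]
  rw [hexp, Finset.sum_mul]
  refine (Finset.abs_sum_le_sum_abs _ _).trans (Finset.sum_le_sum fun j _ => ?_)
  have hcs : |(hA.eigenvectorBasis j).ofLp ⬝ᵥ x| ≤ ‖WithLp.toLp 2 x‖ := by
    have := abs_real_inner_le_norm (WithLp.toLp 2 x) (hA.eigenvectorBasis j)
    simpa [EuclideanSpace.inner_eq_star_dotProduct] using this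
  rw [hdual, abs_mul, abs_mul, abs_pow]
  calc _ = |hA.eigenvalues j| ^ k * |ε ⬝ᵥ (hA.eigenvectorBasis j).ofLp| *
        |(hA.eigenvectorBasis j).ofLp ⬝ᵥ x| := by ring
    _ ≤ _ := mul_le_mul_of_nonneg_left hcs (by positivity)

lemma abs_dotProduct_output_le {N h L : ℕ} {A : Matrix (Fin N) (Fin N) ℝ} (hA : A.IsHermitian)
    {S : Set (Fin N → ℝ)} {K : ℝ} (hK : 0 ≤ K) (hS : ∀ x ∈ S, ‖WithLp.toLp 2 x‖ ≤ K)
    {Y : Matrix (Fin N) (Fin h) ℝ} (hY : ∀ c, Y.col c ∈ S)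
    {WT : Matrix (Fin h) (Fin h) ℝ} {WA : Matrix (Fin N) (Fin h) ℝ} {w : Fin h → ℝ}
    {b a d γ μ : ℝ} (hb : 0 ≤ b) (ha : 0 ≤ a) (hγ : 0 ≤ γ) (hμ : 0 ≤ μ) (hμ1 : μ ≤ 1)
    (hWT : ∀ c, ∑ r, |WT r c| ≤ b) (hWA : ∀ c, ∑ r, |WA r c| ≤ a) (hw : ∑ r, |w r| ≤ d)
    (ε : Fin N → ℝ) :
    |ε ⬝ᵥ (μ • (Y + (∑ k ∈ Finset.Icc 1 (L - 1), ((L : ℝ) * γ ^ k) • (A ^ k * Y * WT ^ k))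
          + γ ^ L • (A ^ L * Y * WT ^ L)) + (1 - μ) • (A * WA)).mulVec w| ≤
      μ * (d * supAbs S ε
        + (∑ k ∈ Finset.Icc 1 (L - 1), (L : ℝ) * γ ^ k *
            ((∑ j, |hA.eigenvalues j| ^ k * |ε ⬝ᵥ (hA.eigenvectorBasis j).ofLp|)
              * (b ^ k * d * K)))
        + γ ^ L * ((∑ j, |hA.eigenvalues j| ^ L * |ε ⬝ᵥ (hA.eigenvectorBasis j).ofLp|)
              * (b ^ L * d * K)))
      + (1 - μ) * ((∑ j, |hA.eigenvalues j| * |ε ⬝ᵥ (hA.eigenvectorBasis j).ofLp|) * (a * d)) := by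
  have hlin : ∀ k, |ε ⬝ᵥ (A ^ k * Y * WT ^ k).mulVec w| ≤
      (∑ j, |hA.eigenvalues j| ^ k * |ε ⬝ᵥ (hA.eigenvectorBasis j).ofLp|) * (b ^ k * d * K) := by
    intro k
    rw [← Matrix.mulVec_mulVec, ← Matrix.mulVec_mulVec]
    refine (abs_dotProduct_pow_mulVec_le hA k ε _).trans
      (mul_le_mul_of_nonneg_left ?_ (Finset.sum_nonneg fun _ _ => by positivity))
    exact norm_toLp_le_of_mem_l1Hull hK hS
      (mulVec_mem_l1Hull hY (sum_abs_pow_mulVec_le hb hWT hw k))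
  have hlink : |ε ⬝ᵥ (A * WA).mulVec w| ≤
      (∑ j, |hA.eigenvalues j| * |ε ⬝ᵥ (hA.eigenvectorBasis j).ofLp|) * (a * d) := by
    have h1 := abs_dotProduct_pow_mulVec_le hA 1 ε (WA.mulVec w)
    simp only [pow_one] at h1
    rw [← Matrix.mulVec_mulVec]
    exact h1.trans (mul_le_mul_of_nonneg_left
      ((norm_toLp_le_sum_abs _).trans (sum_abs_mulVec_le ha hWA hw))
      (Finset.sum_nonneg fun _ _ => by positivity))
  have hid : |ε ⬝ᵥ Y.mulVec w| ≤ d * supAbs S ε :=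
    abs_dotProduct_le_of_mem_l1Hull (fun x hx n => (abs_le_norm_toLp x n).trans (hS x hx)) ε
      (mulVec_mem_l1Hull hY hw)
  simp only [Matrix.add_mulVec, Matrix.smul_mulVec, Matrix.sum_mulVec, dotProduct_add,
    dotProduct_smul, dotProduct_sum, smul_eq_mul]
  refine (abs_add_le _ _).trans (add_le_add ?_ ?_)
  · rw [abs_mul, abs_of_nonneg hμ]
    refine mul_le_mul_of_nonneg_left ((abs_add_le _ _).trans (add_le_add
      ((abs_add_le _ _).trans (add_le_add hid ?_)) ?_)) hμ
    · refine (Finset.abs_sum_le_sum_abs _ _).trans (Finset.sum_le_sum fun k _ => ?_)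
      rw [abs_mul, abs_of_nonneg (by positivity : 0 ≤ (L : ℝ) * γ ^ k)]
      exact mul_le_mul_of_nonneg_left (hlin k) (by positivity)
    · rw [abs_mul, abs_of_nonneg (by positivity : 0 ≤ γ ^ L)]
      exact mul_le_mul_of_nonneg_left (hlin L) (by positivity)
  · rw [abs_mul, abs_of_nonneg (sub_nonneg.2 hμ1)]
    exact mul_le_mul_of_nonneg_left hlink (sub_nonneg.2 hμ1)

end LinearAlgebra

/-- Theorem 1: Rademacher complexity bound for the GPCN-LINK model. -/
theorem gpcn_link_rademacher_bound :
    ∃ C' : ℝ, 0 < C' ∧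
      ∀ (N q h T L M U : ℕ), 0 < N → 0 < q → 0 < h → 0 < T → 0 < L → 0 < M → 0 < U →
      ∀ (X : Matrix (Fin N) (Fin q) ℝ) (A : Matrix (Fin N) (Fin N) ℝ)
        (hA : A.IsHermitian) (σ : ℝ → ℝ) (R : ℝ),
        LipschitzWith 1 σ → σ 0 = 0 → (∀ t, |σ t| ≤ R) →
      ∀ (B : ℕ → ℝ) (BA γ μ : ℝ),
        (∀ l ≤ T + 1, 0 ≤ B l) → 0 ≤ BA → 0 ≤ γ → 0 ≤ μ → μ ≤ 1 →
      tExp N ((M : ℝ) * U / ((M : ℝ) + U) ^ 2) (fun ε =>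
        sSup {y : ℝ | ∃ (W0 : Matrix (Fin q) (Fin h) ℝ)
            (Ws : ℕ → Matrix (Fin h) (Fin h) ℝ)
            (WT : Matrix (Fin h) (Fin h) ℝ)
            (WA : Matrix (Fin N) (Fin h) ℝ)
            (w : Fin h → ℝ),
          (∀ c, ∑ r, |W0 r c| ≤ B 0) ∧
          (∀ l, l < T - 1 → ∀ c, ∑ r, |Ws l r c| ≤ B (l + 1)) ∧
          (∀ c, ∑ r, |WT r c| ≤ B T) ∧
          (∀ c, ∑ r, |WA r c| ≤ BA) ∧
          (∑ r, |w r| ≤ B (T + 1)) ∧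
          y = |∑ n, ε n *
            ((μ • (mlp σ X W0 Ws (T - 1)
                + (∑ k ∈ Finset.Icc 1 (L - 1),
                    ((L : ℝ) * γ ^ k) • (A ^ k * mlp σ X W0 Ws (T - 1) * WT ^ k))
                + γ ^ L • (A ^ L * mlp σ X W0 Ws (T - 1) * WT ^ L))
              + (1 - μ) • (A * WA)).mulVec w) n|})
      ≤ C' * B (T + 1) * μ *
          ((2 : ℝ) ^ T * (∏ l ∈ Finset.range T, B l) *
              Real.sqrt (2 * (M : ℝ) * U / ((M : ℝ) + U) ^ 2) *
              (1 + (∑ k ∈ Finset.Icc 1 (L - 1),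
                      (B T) ^ k * (L : ℝ) * γ ^ k * ∑ j, |hA.eigenvalues j| ^ k)
                 + γ ^ L * (B T) ^ L * ∑ j, |hA.eigenvalues j| ^ L) * frob X
            + ((∑ k ∈ Finset.Icc 1 (L - 1),
                    (B T) ^ k * (L : ℝ) * γ ^ k * ∑ j, |hA.eigenvalues j| ^ k)
                 + γ ^ L * (B T) ^ L * ∑ j, |hA.eigenvalues j| ^ L) *
                Real.sqrt (N : ℝ) * R)
        + (1 - μ) * (2 : ℝ) ^ ((5 : ℝ) / 2) * B (T + 1) * BA *
            (Real.sqrt ((M : ℝ) * U) / ((M : ℝ) + U)) *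
            ∑ i, |hA.eigenvalues i| := by
  refine ⟨1, one_pos, ?_⟩
  intro N q h T L M U hN hq hh hT hL hM hU X A hA σ R hσ hσ0 hσR B BA γ μ hB hBA hγ hμ hμ1
  set p : ℝ := (M : ℝ) * U / ((M : ℝ) + U) ^ 2 with hp_def
  have hM' : (0 : ℝ) < M := Nat.cast_pos.2 hM
  have hU' : (0 : ℝ) < U := Nat.cast_pos.2 hU
  have hp : 0 ≤ p := by positivity
  have hp' : 2 * p ≤ 1 := by
    rw [hp_def, ← mul_div_assoc, div_le_one (by positivity)]
    nlinarith [sq_nonneg ((M : ℝ) - U)]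
  have hR : 0 ≤ R := (abs_nonneg _).trans (hσR 0)
  have hσabs : ∀ s, |σ s| ≤ |s| := fun s => by
    simpa [Real.dist_eq, hσ0] using hσ.dist_le_mul s 0
  obtain ⟨t, rfl⟩ : ∃ t, T = t + 1 := ⟨T - 1, by omega⟩
  simp only [Nat.add_sub_cancel]
  have hBT := hB (t + 1) (by omega)
  have hBT1 := hB (t + 1 + 1) le_rfl
  have hBt : ∀ l ≤ t, 0 ≤ B l := fun l hl => hB l (by omega)
  set b := B (t + 1)
  set d := B (t + 1 + 1)
  set P := ∏ l ∈ Finset.range (t + 1), B l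
  have hP : 0 ≤ P := Finset.prod_nonneg fun l hl => hBt l (by simpa [Nat.lt_succ_iff] using hl)
  have hX := frob_nonneg X
  set S := netClass σ X B t
  have hS : ∀ x ∈ S, ‖WithLp.toLp 2 x‖ ≤ P * frob X := norm_toLp_le_of_mem_netClass hσabs X hBt
  let e : ℕ → (Fin N → ℝ) → ℝ := fun k ε =>
    ∑ j, |hA.eigenvalues j| ^ k * |ε ⬝ᵥ (hA.eigenvectorBasis j).ofLp|
  have he : ∀ k ε, 0 ≤ e k ε := fun k ε => Finset.sum_nonneg fun _ _ => by positivity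
  have hEe : ∀ k, tExp N p (e k) ≤ √(2 * p) * ∑ j, |hA.eigenvalues j| ^ k := by
    intro k
    simp only [e]
    rw [tExp_sum, Finset.mul_sum]
    refine Finset.sum_le_sum fun j _ => ?_
    rw [tExp_const_mul, mul_comm]
    refine mul_le_mul_of_nonneg_right ?_ (by positivity)
    simpa using tExp_abs_dotProduct_le hp hp' (hA.eigenvectorBasis j)
  refine (tExp_mono hp hp' (g := fun ε => μ * (d * supAbs S ε
        + (∑ k ∈ Finset.Icc 1 (L - 1), (L : ℝ) * γ ^ k * (e k ε * (b ^ k * d * (P * frob X))))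
        + γ ^ L * (e L ε * (b ^ L * d * (P * frob X))))
      + (1 - μ) * (e 1 ε * (BA * d))) fun ε => ?_).trans ?_
  · have hμ' := sub_nonneg.2 hμ1
    have hs := supAbs_nonneg S ε
    refine Real.sSup_le ?_ (add_nonneg (mul_nonneg hμ (add_nonneg (add_nonneg (by positivity)
      (Finset.sum_nonneg fun k _ => ?_)) ?_)) ?_)
    · rintro _ ⟨W0, Ws, WT, WA, w, h0, hWs, hWT, hWA, hw, rfl⟩
      simpa only [e, pow_one, dotProduct] using abs_dotProduct_output_le (L := L) hA
        (mul_nonneg hP hX) hS (col_mlp_mem_netClass σ X h0 hWs) hBT hBA hγ hμ hμ1 hWT hWA hw ε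
    · have := he k ε
      positivity
    · have := he L ε
      positivity
    · have := he 1 ε
      positivity
  have hfactor : ∀ (c : ℝ) (f : (Fin N → ℝ) → ℝ),
      tExp N p (fun ε => f ε * c) = tExp N p f * c := fun c f => by
    simp only [mul_comm _ c, tExp_const_mul]
  have hsum : tExp N p (fun ε => ∑ k ∈ Finset.Icc 1 (L - 1),
        (L : ℝ) * γ ^ k * (e k ε * (b ^ k * d * (P * frob X))))
      ≤ (∑ k ∈ Finset.Icc 1 (L - 1), b ^ k * (L : ℝ) * γ ^ k * ∑ j, |hA.eigenvalues j| ^ k)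
        * (√(2 * p) * d * P * frob X) := by
    rw [tExp_sum, Finset.sum_mul]
    refine Finset.sum_le_sum fun k _ => ?_
    rw [tExp_const_mul, hfactor]
    refine (mul_le_mul_of_nonneg_left (mul_le_mul_of_nonneg_right (hEe k) (by positivity))
      (by positivity)).trans (le_of_eq ?_)
    ring
  have hlast : tExp N p (fun ε => γ ^ L * (e L ε * (b ^ L * d * (P * frob X))))
      ≤ (γ ^ L * b ^ L * ∑ j, |hA.eigenvalues j| ^ L) * (√(2 * p) * d * P * frob X) := by
    rw [tExp_const_mul, hfactor]
    refine (mul_le_mul_of_nonneg_left (mul_le_mul_of_nonneg_right (hEe L) (by positivity))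
      (by positivity)).trans (le_of_eq ?_)
    ring
  have hfirst : tExp N p (fun ε => d * supAbs S ε)
      ≤ d * (2 ^ (t + 1) * P * √(2 * p) * frob X) := by
    rw [tExp_const_mul d]
    exact mul_le_mul_of_nonneg_left (tExp_supAbs_netClass_le hp hp' hσ hσ0 X hBt) hBT1
  have hsqrt : √(2 * p) ≤ 2 ^ ((5 : ℝ) / 2) * (√((M : ℝ) * U) / (M + U)) := by
    rw [Real.sqrt_mul zero_le_two, hp_def, Real.sqrt_div (by positivity),
      Real.sqrt_sq (by positivity), Real.sqrt_eq_rpow 2]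
    refine mul_le_mul_of_nonneg_right ?_ (by positivity)
    exact Real.rpow_le_rpow_of_exponent_le one_le_two (by norm_num)
  have hlink : tExp N p (fun ε => (1 - μ) * (e 1 ε * (BA * d)))
      ≤ (1 - μ) * 2 ^ ((5 : ℝ) / 2) * d * BA * (√((M : ℝ) * U) / (M + U))
        * ∑ i, |hA.eigenvalues i| := by
    have hμ' := sub_nonneg.2 hμ1
    have h1 := hEe 1
    simp only [pow_one] at h1
    rw [tExp_const_mul, hfactor]
    refine (mul_le_mul_of_nonneg_left (mul_le_mul_of_nonneg_right (h1.trans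
      (mul_le_mul_of_nonneg_right hsqrt (by positivity))) (by positivity)) hμ').trans
      (le_of_eq ?_)
    ring
  rw [tExp_add, tExp_const_mul, tExp_add, tExp_add,
    show 2 * (M : ℝ) * U / (M + U) ^ 2 = 2 * p by rw [hp_def]; ring]
  refine add_le_add ?_ hlink
  set Q₁ := ∑ k ∈ Finset.Icc 1 (L - 1), b ^ k * (L : ℝ) * γ ^ k * ∑ j, |hA.eigenvalues j| ^ k
  set Q₂ := γ ^ L * b ^ L * ∑ j, |hA.eigenvalues j| ^ L
  have hQ₁ : 0 ≤ Q₁ := Finset.sum_nonneg fun k _ => by positivity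
  have hQ₂ : 0 ≤ Q₂ := by positivity
  have hpow : (Q₁ + Q₂) * (√(2 * p) * d * P * frob X) ≤
      2 ^ (t + 1) * ((Q₁ + Q₂) * (√(2 * p) * d * P * frob X)) :=
    le_mul_of_one_le_left (by positivity) (one_le_pow₀ one_le_two)
  have hextra : 0 ≤ d * ((Q₁ + Q₂) * √N * R) := by positivity
  calc _ ≤ μ * (d * (2 ^ (t + 1) * P * √(2 * p) * frob X)
          + Q₁ * (√(2 * p) * d * P * frob X) + Q₂ * (√(2 * p) * d * P * frob X)) :=
        mul_le_mul_of_nonneg_left (add_le_add (add_le_add hfirst hsum) hlast) hμ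
    _ ≤ μ * (d * (2 ^ (t + 1) * P * √(2 * p) * frob X)
          + 2 ^ (t + 1) * ((Q₁ + Q₂) * (√(2 * p) * d * P * frob X))
          + d * ((Q₁ + Q₂) * √N * R)) :=
        mul_le_mul_of_nonneg_left (by linarith) hμ
    _ = _ := by ring
end

section
/- Let N, h be positive integers, Ā ∈ ℝ^{N×N}, X_0 ∈ ℝ^{N×h}, γ ∈ ℝ, L a positive integer, and W_1, …, W_L ∈ ℝ^{h×h}. Define X_1, …, X_L ∈ ℝ^{N×h} by the scaled residual recursion X_i = X_{i-1} + γ Ā X_{i-1} W_i for i = 1, …, L. Then X_L = Σ_{S ⊆ {1, …, L}} γ^{|S|} Ā^{|S|} X_0 (∏_{i ∈ S} W_i), where the sum ranges over all subsets S of {1, …, L}, the product ∏_{i ∈ S} W_i is taken in increasing order of the indices, and the empty product is the identity matrix. -/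
open Finset

/-- Inserting a strict upper bound into a finite set appends it to the sorted list. -/
theorem Finset.sort_insert_of_forall_lt {α : Type*} [LinearOrder α] {s : Finset α} {a : α}
    (hs : ∀ b ∈ s, b < a) :
    (insert a s).sort (· ≤ ·) = s.sort (· ≤ ·) ++ [a] := by
  refine List.Perm.eq_of_pairwise' (r := (· ≤ ·)) (Finset.pairwise_sort _ _) ?_ ?_
  · simpa [List.pairwise_append] using fun b hb => (hs b hb).le
  · rw [List.perm_ext_iff_of_nodup (Finset.sort_nodup _ _)]
    · simp [or_comm]
    · simpa [List.nodup_append] using fun b hb => (hs b hb).ne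

/-- Unrolling the scaled residual recursion `X_i = X_{i-1} + γ Ā X_{i-1} W_i`
with distinct weight matrices yields a sum over subsets `S ⊆ {1,…,L}`, the
weights of each subset being multiplied in increasing order of their indices. -/
theorem generalized_scaled_residual_unrolling
    (N h : ℕ) (hN : 0 < N) (hh : 0 < h)
    (A : Matrix (Fin N) (Fin N) ℝ)
    (X0 : Matrix (Fin N) (Fin h) ℝ)
    (γ : ℝ) (L : ℕ) (hL : 0 < L)
    (W : ℕ → Matrix (Fin h) (Fin h) ℝ)
    (Xs : ℕ → Matrix (Fin N) (Fin h) ℝ)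
    (hX0 : Xs 0 = X0)
    (hrec : ∀ i, i < L → Xs (i + 1) = Xs i + γ • (A * Xs i * W (i + 1))) :
    Xs L = ∑ S ∈ (Finset.Icc 1 L).powerset,
      (γ ^ S.card) • (A ^ S.card * X0 * ((S.sort (· ≤ ·)).map W).prod) := by
  clear hL
  induction L with
  | zero => simp [hX0]
  | succ L ih =>
    have hnotMem : L + 1 ∉ Finset.Icc 1 L := by simp
    rw [← Finset.insert_Icc_right_eq_Icc_add_one (by lia), Finset.sum_powerset_insert hnotMem,
      hrec L L.lt_succ_self, ih fun i hi => hrec i (by lia)]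
    congr 1
    rw [Matrix.mul_sum, Matrix.sum_mul, Finset.smul_sum]
    refine Finset.sum_congr rfl fun S hS => ?_
    have hlt : ∀ b ∈ S, b < L + 1 := fun b hb =>
      Nat.lt_succ_of_le (Finset.mem_Icc.mp (Finset.mem_powerset.mp hS hb)).2
    rw [Finset.sort_insert_of_forall_lt hlt,
      Finset.card_insert_of_notMem fun hL => (hlt _ hL).false]
    simp [pow_succ', Matrix.mul_assoc, smul_smul]
end
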